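/- Let x₀ < x₂ be real numbers and C ≥ 0. Let φ : (x₀,x₂) → ℝ be a function admitting a function φ′ : (x₀,x₂) → ℝ, integrable on every compact subinterval of (x₀,x₂), such that φ(b) − φ(a) = ∫_a^b φ′(x) dx whenever x₀ < a ≤ b < x₂, and |φ′(x)|·min(x−x₀, x₂−x) ≤ C for almost every x ∈ (x₀,x₂). Assume φ is Lebesgue-integrable on (x₀,x₂). Then for all a, b with x₀ ≤ a < b ≤ x₂: (i) |m(φ,(a,b)) − m(φ,(x₀,x₂))| ≤ C·(4 + (x₂−x₀)/(b−a)), and (ii) (1/(b−a)) ∫_a^b |φ(x) − m(φ,(a,b))| dx ≤ 8C. -/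

import Mathlib

open MeasureTheory Set

lemma aux_left (p a c C : ℝ) (hpa : p ≤ a) (hac : a ≤ c) (hpc : p < c) (hC : 0 ≤ C) (f : ℝ → ℝ)
    (hf : IntervalIntegrable f volume a c)
    (h : ∀ x, p < x → x ≤ c → |f x - f c| ≤ C * (Real.log (c - p) - Real.log (x - p))) :
    ∫ x in a..c, |f x - f c| ≤ C * (c - a) := by
  have hlog : IntervalIntegrable (fun x => Real.log (x - p)) volume a c := by
    have := (intervalIntegral.intervalIntegrable_log' (a := a - p) (b := c - p)).comp_sub_right p
    simpa using this
  have h1 : ∫ x in a..c, |f x - f c| ≤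
      ∫ x in a..c, C * (Real.log (c - p) - Real.log (x - p)) := by
    apply intervalIntegral.integral_mono_on_of_le_Ioo hac
    · exact (hf.sub intervalIntegrable_const).abs
    · exact (intervalIntegrable_const.sub hlog).const_mul C
    · intro x hx
      exact h x (lt_of_le_of_lt hpa hx.1) hx.2.le
  refine h1.trans ?_
  rw [intervalIntegral.integral_const_mul, intervalIntegral.integral_sub intervalIntegrable_const hlog,
    intervalIntegral.integral_comp_sub_right (fun x => Real.log x) p, integral_log,
    intervalIntegral.integral_const, smul_eq_mul]
  apply mul_le_mul_of_nonneg_left _ hC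
  rcases hpa.eq_or_lt with rfl | hpa
  · simp
  · have := Real.log_le_log (sub_pos.2 hpa) (sub_le_sub_right hac p)
    nlinarith [mul_le_mul_of_nonneg_left this (sub_pos.2 hpa).le]

lemma aux_right (p c b C : ℝ) (hpa : b ≤ p) (hac : c ≤ b) (hpc : c < p) (hC : 0 ≤ C) (f : ℝ → ℝ)
    (hf : IntervalIntegrable f volume c b)
    (h : ∀ x, c ≤ x → x < p → |f x - f c| ≤ C * (Real.log (p - c) - Real.log (p - x))) :
    ∫ x in c..b, |f x - f c| ≤ C * (b - c) := by
  have hlog : IntervalIntegrable (fun x => Real.log (p - x)) volume c b := by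
    have := (intervalIntegral.intervalIntegrable_log' (a := p - c) (b := p - b)).comp_sub_left p
    simpa using this
  have h1 : ∫ x in c..b, |f x - f c| ≤
      ∫ x in c..b, C * (Real.log (p - c) - Real.log (p - x)) := by
    apply intervalIntegral.integral_mono_on_of_le_Ioo hac
    · exact (hf.sub intervalIntegrable_const).abs
    · exact (intervalIntegrable_const.sub hlog).const_mul C
    · intro x hx
      exact h x hx.1.le (lt_of_lt_of_le hx.2 hpa)
  refine h1.trans ?_
  rw [intervalIntegral.integral_const_mul, intervalIntegral.integral_sub intervalIntegrable_const hlog,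
    intervalIntegral.integral_comp_sub_left (fun x => Real.log x) p, integral_log,
    intervalIntegral.integral_const, smul_eq_mul]
  apply mul_le_mul_of_nonneg_left _ hC
  rcases hpa.eq_or_lt with rfl | hpa
  · simp
  · have := Real.log_le_log (sub_pos.2 hpa) (sub_le_sub_left hac p)
    nlinarith [mul_le_mul_of_nonneg_left this (sub_pos.2 hpa).le]

lemma aux_mean (a b K k : ℝ) (hab : a < b) (f : ℝ → ℝ)
    (hf : IntervalIntegrable f volume a b)
    (h : ∫ x in a..b, |f x - k| ≤ K * (b - a)) :
    |(b - a)⁻¹ * (∫ x in a..b, f x) - k| ≤ K := by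
  have hba : 0 < b - a := sub_pos.2 hab
  have h1 : (b - a)⁻¹ * (∫ x in a..b, f x) - k = (b - a)⁻¹ * ∫ x in a..b, (f x - k) := by
    rw [intervalIntegral.integral_sub hf intervalIntegrable_const, intervalIntegral.integral_const,
      smul_eq_mul]
    field_simp
  rw [h1, abs_mul, abs_of_pos (inv_pos.2 hba), inv_mul_le_iff₀ hba, mul_comm]
  exact (intervalIntegral.abs_integral_le_integral_abs hab.le).trans h

/-- The single-interval form of Lemma A.2 of the paper: mean-value estimates for a
function with a logarithmic-singularity bound `los(φ) ≤ C` at the two endpoints. -/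
theorem stmt2
    (x₀ x₂ : ℝ) (hx : x₀ < x₂) (C : ℝ) (hC : 0 ≤ C)
    (φ φ' : ℝ → ℝ)
    (hint : ∀ a b : ℝ, x₀ < a → a ≤ b → b < x₂ → IntervalIntegrable φ' volume a b)
    (hftc : ∀ a b : ℝ, x₀ < a → a ≤ b → b < x₂ →
      φ b - φ a = ∫ x in a..b, φ' x)
    (hbound : ∀ᵐ x ∂(volume : Measure ℝ), x ∈ Ioo x₀ x₂ →
      |φ' x| * min (x - x₀) (x₂ - x) ≤ C)
    (hφint : IntegrableOn φ (Ioo x₀ x₂) volume) :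
    ∀ a b : ℝ, x₀ ≤ a → a < b → b ≤ x₂ →
      |(b - a)⁻¹ * (∫ x in Ioo a b, φ x) -
          (x₂ - x₀)⁻¹ * (∫ x in Ioo x₀ x₂, φ x)| ≤ C * (4 + (x₂ - x₀) / (b - a)) ∧
      (b - a)⁻¹ * (∫ x in Ioo a b, |φ x - (b - a)⁻¹ * (∫ y in Ioo a b, φ y)|) ≤
        8 * C := by
  have hI : ∀ a b : ℝ, x₀ ≤ a → a ≤ b → b ≤ x₂ → IntervalIntegrable φ volume a b := by
    intro a b h1 h2 h3
    rw [intervalIntegrable_iff_integrableOn_Ioo_of_le h2]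
    exact hφint.mono_set (Ioo_subset_Ioo h1 h3)
  obtain ⟨d, hd⟩ : ∃ d, d = (x₀ + x₂) / 2 := ⟨_, rfl⟩
  have hL : ∀ x y, x₀ < x → x ≤ y → y ≤ d →
      |φ y - φ x| ≤ C * (Real.log (y - x₀) - Real.log (x - x₀)) := by
    intro x y h1 h2 h3
    rw [hftc x y h1 h2 (by linarith)]
    have hii : IntervalIntegrable (fun t => C * (t - x₀)⁻¹) volume x y := by
      apply ContinuousOn.intervalIntegrable
      rw [uIcc_of_le h2]
      refine continuousOn_const.mul (ContinuousOn.inv₀ (by fun_prop) ?_)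
      intro t ht
      have := ht.1
      linarith
    have := intervalIntegral.norm_integral_le_of_norm_le (f := φ') h2 (by
      filter_upwards [hbound] with t ht htm
      have h4 := htm.1
      have h5 := htm.2
      have h6 := ht ⟨by linarith, by linarith⟩
      rw [min_eq_left (by linarith)] at h6
      rw [Real.norm_eq_abs, ← div_eq_mul_inv, le_div_iff₀ (by linarith)]
      exact h6) hii
    rw [Real.norm_eq_abs] at this
    refine this.trans (le_of_eq ?_)
    rw [intervalIntegral.integral_const_mul,
      intervalIntegral.integral_comp_sub_right (fun x => x⁻¹) x₀,
      integral_inv_of_pos (by linarith) (by linarith), Real.log_div (by linarith) (by linarith)]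
  have hR : ∀ x y, d ≤ x → x ≤ y → y < x₂ →
      |φ y - φ x| ≤ C * (Real.log (x₂ - x) - Real.log (x₂ - y)) := by
    intro x y h1 h2 h3
    rw [hftc x y (by linarith) h2 (by linarith)]
    have hii : IntervalIntegrable (fun t => C * (x₂ - t)⁻¹) volume x y := by
      apply ContinuousOn.intervalIntegrable
      rw [uIcc_of_le h2]
      refine continuousOn_const.mul (ContinuousOn.inv₀ (by fun_prop) ?_)
      intro t ht
      have := ht.2
      linarith
    have := intervalIntegral.norm_integral_le_of_norm_le (f := φ') h2 (by
      filter_upwards [hbound] with t ht htm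
      have h4 := htm.1
      have h5 := htm.2
      have h6 := ht ⟨by linarith, by linarith⟩
      rw [min_eq_right (by linarith)] at h6
      rw [Real.norm_eq_abs, ← div_eq_mul_inv, le_div_iff₀ (by linarith)]
      exact h6) hii
    rw [Real.norm_eq_abs] at this
    refine this.trans (le_of_eq ?_)
    rw [intervalIntegral.integral_const_mul,
      intervalIntegral.integral_comp_sub_left (fun x => x⁻¹) x₂,
      integral_inv_of_pos (by linarith) (by linarith), Real.log_div (by linarith) (by linarith)]
  have hleft : ∀ a c, x₀ ≤ a → a ≤ c → x₀ < c → c ≤ d →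
      ∫ x in a..c, |φ x - φ c| ≤ C * (c - a) := by
    intro a c h1 h2 h3 h4
    refine aux_left x₀ a c C h1 h2 h3 hC φ (hI _ _ h1 h2 (by linarith)) ?_
    intro x h5 h6
    rw [abs_sub_comm]
    exact hL x c h5 h6 h4
  have hright : ∀ c b, d ≤ c → c ≤ b → c < x₂ → b ≤ x₂ →
      ∫ x in c..b, |φ x - φ c| ≤ C * (b - c) := by
    intro c b h1 h2 h3 h4
    refine aux_right x₂ c b C h4 h2 h3 hC φ (hI _ _ (by linarith) h2 h4) ?_
    intro x h5 h6
    exact hR c x h1 h5 h6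
  have hmid : ∀ a b, x₀ ≤ a → a ≤ d → d ≤ b → b ≤ x₂ →
      ∫ x in a..b, |φ x - φ d| ≤ C * (b - a) := by
    intro a b h1 h2 h3 h4
    rw [← intervalIntegral.integral_add_adjacent_intervals (b := d)
      ((hI a d h1 h2 (by linarith)).sub intervalIntegrable_const).abs
      ((hI d b (by linarith) h3 h4).sub intervalIntegrable_const).abs]
    have := hleft a d h1 h2 (by linarith) le_rfl
    have := hright d b le_rfl h3 (by linarith) h4
    linarith
  have hlogb : ∀ u v w : ℝ, 0 < u → u ≤ v → 0 < w → w ≤ x₂ - x₀ →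
      C * (Real.log w - Real.log v) ≤ C * ((x₂ - x₀) / u) := by
    intro u v w hu huv hw hwL
    apply mul_le_mul_of_nonneg_left _ hC
    rw [← Real.log_div hw.ne' (by linarith)]
    have h1 : w / v ≤ (x₂ - x₀) / u := by gcongr
    have h2 := Real.log_le_sub_one_of_pos (div_pos hw (hu.trans_le huv))
    linarith
  intro a b ha hab hb
  have hba : 0 < b - a := sub_pos.2 hab
  have key : ∃ c, ∫ x in a..b, |φ x - φ c| ≤ C * (b - a) ∧
      |φ c - φ d| ≤ C * ((x₂ - x₀) / (b - a)) := by
    rcases le_total b d with h | h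
    · refine ⟨b, hleft a b ha hab.le (by linarith) h, ?_⟩
      rw [abs_sub_comm]
      exact (hL b d (by linarith) h le_rfl).trans
        (hlogb _ _ _ hba (by linarith) (by linarith) (by linarith))
    · rcases le_total a d with h' | h'
      · refine ⟨d, hmid a b ha h' h hb, ?_⟩
        rw [sub_self, abs_zero]
        exact mul_nonneg hC (div_nonneg (by linarith) hba.le)
      · refine ⟨a, hright a b h' hab.le (by linarith) hb, ?_⟩
        exact (hR d a le_rfl h' (by linarith)).trans
          (hlogb _ _ _ hba (by linarith) (by linarith) (by linarith))
  obtain ⟨c, hc1, hc2⟩ := key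
  have hIab := hI a b ha hab.le hb
  have m1 := aux_mean a b C (φ c) hab φ hIab hc1
  have m2 := aux_mean x₀ x₂ C (φ d) hx φ (hI _ _ le_rfl hx.le le_rfl)
    (hmid x₀ x₂ le_rfl (by linarith) (by linarith) le_rfl)
  simp only [← integral_Ioc_eq_integral_Ioo]
  simp only [← intervalIntegral.integral_of_le hab.le, ← intervalIntegral.integral_of_le hx.le]
  generalize (b - a)⁻¹ * (∫ x in a..b, φ x) = M at *
  constructor
  · rw [abs_le] at *
    constructor <;> linarith
  · rw [inv_mul_le_iff₀ hba]
    have : ∫ x in a..b, |φ x - M| ≤ ∫ x in a..b, (|φ x - φ c| + C) := by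
      apply intervalIntegral.integral_mono_on hab.le
      · exact (hIab.sub intervalIntegrable_const).abs
      · exact (hIab.sub intervalIntegrable_const).abs.add intervalIntegrable_const
      · intro x _
        rw [abs_sub_comm] at m1
        linarith [abs_sub_le (φ x) (φ c) M]
    rw [intervalIntegral.integral_add (hIab.sub intervalIntegrable_const).abs
      intervalIntegrable_const, intervalIntegral.integral_const, smul_eq_mul] at this
    nlinarith [mul_nonneg hC hba.le]
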